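/- arXiv:2504.08715 — 2 statements merged into one kernel-verified Lean document; each statement's English description precedes it below -/
import Mathlib

section
/- Define H(x) := x·log(1/x) + (1−x)·log(1/(1−x)). Let ᾱ > 0, d ≥ 1 with ᾱd ≥ 16 and let p ∈ [0,1]. If 0 ≤ p ≤ e^{−ᾱd/16}, then −(1/8)ᾱp + (1/d)H(p) ≤ (1/8)ᾱ·e^{−ᾱd/16}. If e^{−ᾱd/16} ≤ p ≤ 1/2, then −(1/8)ᾱp + (1/d)H(p) ≤ 0. If 1/2 ≤ p ≤ 1 and ᾱd ≥ 16·log 2, then −(1/8)ᾱp + (1/d)H(p) ≤ 0. -/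
theorem aux_one_sub (p : ℝ) (hp0 : 0 ≤ p) (hp1 : p ≤ 1) :
    (1 - p) * Real.log (1 / (1 - p)) ≤ p := by
  rcases hp1.eq_or_lt with h | h
  · subst h; norm_num
  · have h1 : 0 < 1 - p := by linarith
    have h2 := Real.log_le_sub_one_of_pos (one_div_pos.mpr h1)
    have h3 := mul_le_mul_of_nonneg_left h2 h1.le
    have h4 : (1 - p) * (1 / (1 - p) - 1) = p := by field_simp; ring
    linarith

theorem aux_small (p t : ℝ) (hp0 : 0 ≤ p) :
    p * Real.log (1 / p) ≤ p * t + Real.exp (-t) - p := by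
  rcases hp0.eq_or_lt with h | h
  · subst h; simp [Real.exp_nonneg]
  · have h2 := Real.log_le_sub_one_of_pos (div_pos (Real.exp_pos (-t)) h)
    rw [Real.log_div (Real.exp_pos _).ne' h.ne', Real.log_exp] at h2
    have h3 := mul_le_mul_of_nonneg_left h2 h.le
    have h4 : p * (Real.exp (-t) / p - 1) = Real.exp (-t) - p := by field_simp
    rw [one_div, Real.log_inv]
    linarith

theorem aux_large (p t : ℝ) (hp : Real.exp (-t) ≤ p) :
    p * Real.log (1 / p) ≤ p * t := by
  have h : 0 < p := (Real.exp_pos _).trans_le hp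
  have h1 := Real.log_le_log (Real.exp_pos _) hp
  rw [Real.log_exp] at h1
  apply mul_le_mul_of_nonneg_left _ h.le
  rw [one_div, Real.log_inv]
  linarith

theorem aux_scale (α d p X c : ℝ) (hd : 1 ≤ d)
    (h : X ≤ 2 * (α * d / 16) * p + 2 * (α * d / 16) * c) :
    -(1 / 8) * α * p + (1 / d) * X ≤ (1 / 8) * α * c := by
  have hd0 : 0 < d := by linarith
  have h1 := mul_le_mul_of_nonneg_left h (one_div_pos.mpr hd0).le
  have h2 : (1 / d) * (2 * (α * d / 16) * p + 2 * (α * d / 16) * c)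
      = 1 / 8 * α * p + 1 / 8 * α * c := by field_simp; ring
  linarith

theorem entropy_three_cases (α d p : ℝ) (hα : 0 < α) (hd : 1 ≤ d)
    (hαd : 16 ≤ α * d) (hp0 : 0 ≤ p) (hp1 : p ≤ 1) :
    (p ≤ Real.exp (-(α * d) / 16) →
      -(1 / 8) * α * p +
          (1 / d) * (p * Real.log (1 / p) + (1 - p) * Real.log (1 / (1 - p))) ≤
        (1 / 8) * α * Real.exp (-(α * d) / 16)) ∧
    (Real.exp (-(α * d) / 16) ≤ p → p ≤ 1 / 2 →
      -(1 / 8) * α * p +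
          (1 / d) * (p * Real.log (1 / p) + (1 - p) * Real.log (1 / (1 - p))) ≤ 0) ∧
    (16 * Real.log 2 ≤ α * d → 1 / 2 ≤ p →
      -(1 / 8) * α * p +
          (1 / d) * (p * Real.log (1 / p) + (1 - p) * Real.log (1 / (1 - p))) ≤ 0) := by
  have ht : 1 ≤ α * d / 16 := by linarith
  have hneg : -(α * d) / 16 = -(α * d / 16) := by ring
  rw [hneg]
  have hA := aux_one_sub p hp0 hp1
  have hpt : p ≤ α * d / 16 * p := le_mul_of_one_le_left hp0 ht
  have key : Real.exp (-(α * d / 16)) ≤ p →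
      -(1 / 8) * α * p +
          (1 / d) * (p * Real.log (1 / p) + (1 - p) * Real.log (1 / (1 - p))) ≤ 0 := by
    intro h
    have hB := aux_large p _ h
    have := aux_scale α d p
      (p * Real.log (1 / p) + (1 - p) * Real.log (1 / (1 - p))) 0 hd (by linarith)
    linarith
  refine ⟨fun _ => ?_, fun h _ => key h, fun _ h => key ?_⟩
  · apply aux_scale α d p _ _ hd
    have hB := aux_small p (α * d / 16) hp0
    have hq : Real.exp (-(α * d / 16)) ≤ α * d / 16 * Real.exp (-(α * d / 16)) :=
      le_mul_of_one_le_left (Real.exp_pos _).le ht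
    have := Real.exp_pos (-(α * d / 16))
    linarith
  · refine le_trans ?_ h
    rw [Real.exp_neg, one_div]
    apply inv_anti₀ (by norm_num)
    have := Real.add_one_le_exp (α * d / 16)
    linarith
end

section
/- Let (P, ω, ∼) be a polymer model with nonnegative weights, and suppose f, g: P → [0,∞) satisfy the Kotecký–Preiss condition: for every polymer A, Σ_{A' ≁ A} ω(A')·e^{f(A')+g(A')} ≤ f(A). Define the cluster weight ω(Γ) := φ(H(Γ))·Π_{A∈Γ}ω(A) where φ is the Ursell function. Then for every polymer A, Σ_{Γ cluster, Γ ≁ A} |ω(Γ)|·e^{g(Γ)} ≤ f(A), where g(Γ) := Σ_{A'∈Γ} g(A'), and the cluster expansion Σ_Γ ω(Γ) converges absolutely to log Ξ_P. -/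
open scoped Classical

noncomputable section

/-- The incompatibility graph of a tuple of polymers: vertices are the indices,
with an edge between distinct indices carrying incompatible polymers. -/
def incompGraph {ι : Type*} (compat : ι → ι → Prop) {n : ℕ} (Γ : Fin n → ι) :
    SimpleGraph (Fin n) :=
  SimpleGraph.fromRel (fun i j => ¬ compat (Γ i) (Γ j))

/-- The Ursell function of a graph on `Fin n`: `(1/n!) ∑_{E ⊆ E(H), (V,E) connected} (-1)^{|E|}`. -/
def ursell (n : ℕ) (H : SimpleGraph (Fin n)) : ℝ :=
  (1 / (n.factorial : ℝ)) *
    ∑ s ∈ H.edgeFinset.powerset.filter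
        (fun (s : Finset (Sym2 (Fin n))) => (SimpleGraph.fromEdgeSet (↑s : Set (Sym2 (Fin n)))).Connected),
      (-1 : ℝ) ^ s.card

/-- A cluster: a nonempty finite ordered tuple of polymers whose incompatibility
graph is connected. -/
structure Cluster (ι : Type*) (compat : ι → ι → Prop) where
  n : ℕ
  npos : 0 < n
  Γ : Fin n → ι
  conn : (incompGraph compat Γ).Connected

/-- The weight of a cluster. -/
def clusterWeight {ι : Type*} (compat : ι → ι → Prop) (w : ι → ℝ)
    (Γ : Cluster ι compat) : ℝ :=
  ursell Γ.n (incompGraph compat Γ.Γ) * ∏ i, w (Γ.Γ i)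

/-- The polymer partition function: sum over sets of pairwise compatible polymers. -/
def polymerPartition {ι : Type*} [Fintype ι] (compat : ι → ι → Prop) (w : ι → ℝ) : ℝ :=
  ∑ Θ ∈ (Finset.univ : Finset (Finset ι)).filter
      (fun Θ => ∀ A ∈ Θ, ∀ B ∈ Θ, A ≠ B → compat A B),
    ∏ A ∈ Θ, w A


namespace KP

/-- shift -/
def D {α : Type*} (x : α) (a : List α → ℝ) : List α → ℝ := fun l => a (x :: l)

/-- shuffle product -/
def sh {α : Type*} : List α → (List α → ℝ) → (List α → ℝ) → ℝ
  | [], a, b => a [] * b []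
  | x :: l, a, b => sh l (D x a) b + sh l a (D x b)

section alg
variable {α β : Type*}

theorem sh_add_left (l : List α) : ∀ (a a' b : List α → ℝ),
    sh l (fun m => a m + a' m) b = sh l a b + sh l a' b := by
  induction l with
  | nil => intros; simp [sh]; ring
  | cons x l ih =>
    intro a a' b
    have h1 : D x (fun m => a m + a' m) = fun m => D x a m + D x a' m := rfl
    simp only [sh, h1, ih]; ring

theorem sh_smul_left (l : List α) (c : ℝ) : ∀ (a b : List α → ℝ),
    sh l (fun m => c * a m) b = c * sh l a b := by
  induction l with
  | nil => intros; simp [sh]; ring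
  | cons x l ih =>
    intro a b
    have h1 : D x (fun m => c * a m) = fun m => c * D x a m := rfl
    simp only [sh, h1, ih]; ring

theorem sh_comm (l : List α) : ∀ (a b : List α → ℝ), sh l a b = sh l b a := by
  induction l with
  | nil => intros; simp [sh]; ring
  | cons x l ih =>
    intro a b
    simp only [sh]; rw [ih, ih a]; ring

theorem sh_add_right (l : List α) (a b b' : List α → ℝ) :
    sh l a (fun m => b m + b' m) = sh l a b + sh l a b' := by
  rw [sh_comm, sh_add_left, sh_comm, sh_comm l b']

theorem sh_smul_right (l : List α) (c : ℝ) (a b : List α → ℝ) :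
    sh l a (fun m => c * b m) = c * sh l a b := by
  rw [sh_comm, sh_smul_left, sh_comm]

theorem sh_sub_left (l : List α) (a a' b : List α → ℝ) :
    sh l (fun m => a m - a' m) b = sh l a b - sh l a' b := by
  have h : (fun m => a m - a' m) = fun m => a m + (-1) * a' m := by funext m; ring
  rw [h, sh_add_left, sh_smul_left]; ring

theorem sh_assoc (l : List α) : ∀ (a b c : List α → ℝ),
    sh l (fun m => sh m a b) c = sh l a (fun m => sh m b c) := by
  induction l with
  | nil => intros; simp [sh]; ring
  | cons x l ih =>
    intro a b c
    have h1 : D x (fun m => sh m a b) = fun m => sh m (D x a) b + sh m a (D x b) := rfl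
    have h2 : D x (fun m => sh m b c) = fun m => sh m (D x b) c + sh m b (D x c) := rfl
    simp only [sh]
    rw [h1, h2, sh_add_left, sh_add_right, ih, ih, ih]; ring

theorem sh_abs (l : List α) : ∀ (a b : List α → ℝ),
    |sh l a b| ≤ sh l (fun m => |a m|) (fun m => |b m|) := by
  induction l with
  | nil => intros; simp [sh, abs_mul]
  | cons x l ih =>
    intro a b
    exact (abs_add_le _ _).trans (add_le_add (ih _ _) (ih _ _))

theorem sh_congr (l : List α) : ∀ (a a' b b' : List α → ℝ),
    (∀ m, List.Sublist m l → a m = a' m) → (∀ m, List.Sublist m l → b m = b' m) →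
    sh l a b = sh l a' b' := by
  induction l with
  | nil => intro a a' b b' h1 h2; simp [sh, h1, h2]
  | cons x l ih =>
    intro a a' b b' h1 h2
    simp only [sh]
    rw [ih (D x a) (D x a') b b' (fun m hm => h1 _ (hm.cons_cons x)) (fun m hm => h2 _ (hm.cons x)),
      ih a a' (D x b) (D x b') (fun m hm => h1 _ (hm.cons x)) (fun m hm => h2 _ (hm.cons_cons x))]

theorem sh_zero_left (l : List α) (b : List α → ℝ) : sh l (fun _ => 0) b = 0 := by
  have := sh_smul_left l 0 (fun _ => 0) b
  simpa using this

theorem sh_top (l : List α) : ∀ (a b : List α → ℝ),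
    (∀ m, List.Sublist m l → m.length < l.length → a m = 0) → sh l a b = a l * b [] := by
  induction l with
  | nil => intros; rfl
  | cons x l ih =>
    intro a b h
    simp only [sh]
    rw [ih (D x a) b (fun m hm hl => h _ (hm.cons_cons x) (by simpa using hl))]
    rw [sh_congr l a (fun _ => 0) (D x b) (D x b)
      (fun m hm => h _ (hm.cons x) (by have := hm.length_le; simp; omega)) (fun _ _ => rfl),
      sh_zero_left]
    simp [D]

theorem sh_top_sub (l : List α) (a a' b : List α → ℝ) (hb : b [] = 1)
    (h : ∀ m, List.Sublist m l → m.length < l.length → a m = a' m) :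
    sh l a b - a l = sh l a' b - a' l := by
  have := sh_top l (fun m => a m - a' m) b (fun m h1 h2 => by simp [h m h1 h2])
  rw [sh_sub_left, hb] at this
  linarith

theorem sh_cancel (a a' b : List α → ℝ) (hb : b [] = 1) (h : ∀ l, sh l a b = sh l a' b) :
    ∀ l, a l = a' l := by
  suffices ∀ n, ∀ l : List α, l.length = n → a l = a' l from fun l => this _ l rfl
  intro n
  induction n using Nat.strong_induction_on with
  | _ n ih =>
    intro l hl
    have := sh_top_sub l a a' b hb (fun m _ h2 => ih m.length (hl ▸ h2) m rfl)
    rw [h l] at this; linarith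

theorem sh_mult (r0 : α → ℝ) (l : List α) : ∀ (a b : List α → ℝ),
    sh l (fun m => (m.map r0).prod * a m) (fun m => (m.map r0).prod * b m)
      = (l.map r0).prod * sh l a b := by
  induction l with
  | nil => intros; simp [sh]
  | cons x l ih =>
    intro a b
    have h1 : ∀ a : List α → ℝ, D x (fun m => (m.map r0).prod * a m)
        = fun m => r0 x * ((m.map r0).prod * D x a m) := by
      intro a; funext m; simp [D, mul_assoc]
    simp only [sh, h1, sh_smul_left, sh_smul_right, ih, List.map_cons, List.prod_cons]; ring

theorem sh_map (F : β → α) (l : List β) : ∀ (a b : List α → ℝ),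
    sh (l.map F) a b = sh l (fun m => a (m.map F)) (fun m => b (m.map F)) := by
  induction l with
  | nil => intros; rfl
  | cons x l ih =>
    intro a b
    simp only [List.map_cons, sh, ih]; rfl

theorem sh_finset [DecidableEq α] (l : List α) : ∀ (a b : Finset α → ℝ), l.Nodup →
    sh l (fun m => a m.toFinset) (fun m => b m.toFinset)
      = ∑ T ∈ l.toFinset.powerset, a T * b (l.toFinset \ T) := by
  induction l with
  | nil => intros; simp [sh]
  | cons x l ih =>
    intro a b hl
    rw [List.nodup_cons] at hl
    have hx : x ∉ l.toFinset := by simpa using hl.1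
    have h1 : ∀ a : Finset α → ℝ, D x (fun m => a m.toFinset)
        = fun m => (fun S => a (insert x S)) m.toFinset := by
      intro a; funext m; simp [D]
    simp only [sh, h1]
    rw [ih (fun S => a (insert x S)) b hl.2, ih a (fun S => b (insert x S)) hl.2,
      List.toFinset_cons, Finset.sum_powerset_insert hx, add_comm]
    congr 1
    · apply Finset.sum_congr rfl
      intro T hT
      rw [Finset.mem_powerset] at hT
      rw [Finset.insert_sdiff_of_notMem _ (fun h => hx (hT h))]
    · apply Finset.sum_congr rfl
      intro T hT
      congr 2
      ext y
      simp only [Finset.mem_sdiff, Finset.mem_insert]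
      constructor
      · rintro ⟨h1, h2⟩
        refine ⟨Or.inr h1, ?_⟩
        rintro (h | h)
        · exact hx (h ▸ h1)
        · exact h2 h
      · rintro ⟨h1, h2⟩; tauto

end alg

section defu
variable {ι : Type*} (compat : ι → ι → Prop)

/-- hard core indicator -/
def hh (l : List ι) : ℝ := if l.Pairwise compat then 1 else 0

/-- fuel version of the Ursell functions -/
def uf : ℕ → List ι → ℝ
  | 0, _ => 0
  | _ + 1, [] => 0
  | n + 1, v :: l => hh compat (v :: l) - (sh l (D v (uf n)) (hh compat) - uf n (v :: l))

/-- truncated (Ursell) functions -/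
def uu (l : List ι) : ℝ := uf compat l.length l

theorem hh_nil : hh compat [] = 1 := by simp [hh]

theorem uf_stable (n : ℕ) : ∀ l : List ι, l.length ≤ n → uf compat (n + 1) l = uf compat n l := by
  induction n with
  | zero => intro l hl; have : l = [] := by simpa using hl
            subst this; simp [uf]
  | succ n ih =>
    intro l hl
    cases l with
    | nil => simp [uf]
    | cons v l =>
      rw [uf, uf]
      congr 1
      apply sh_top_sub l (D v (uf compat (n+1))) (D v (uf compat n)) _ (hh_nil compat)
      intro m _ hm
      apply ih
      simp at hl ⊢; omega

theorem uf_eq (n : ℕ) (l : List ι) (h : l.length ≤ n) : uf compat n l = uu compat l := by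
  induction n, h using Nat.le_induction with
  | base => rfl
  | succ n hn ih => rw [uf_stable compat n l hn, ih]

theorem uu_nil : uu compat [] = 0 := by simp [uu, uf]

theorem uu_rec (v : ι) (l : List ι) :
    sh l (D v (uu compat)) (hh compat) = hh compat (v :: l) := by
  have h1 : uu compat (v :: l) = uf compat (l.length + 1) (v :: l) := rfl
  rw [uf] at h1
  have h2 := sh_top_sub l (D v (uu compat)) (D v (uf compat l.length)) _ (hh_nil compat)
    (fun m _ hm => (uf_eq compat _ _ (by simp; omega)).symm)
  simp only [D] at h2 h1 ⊢
  linarith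

/-- compatibility restriction -/
def rr (v x : ι) : ℝ := if compat x v then 1 else 0

theorem hh_cons (hsymm : Symmetric compat) (v : ι) (l : List ι) :
    hh compat (v :: l) = (l.map (rr compat v)).prod * hh compat l := by
  have : (l.map (rr compat v)).prod = if ∀ y ∈ l, compat v y then 1 else 0 := by
    induction l with
    | nil => simp
    | cons x l ih =>
      simp only [List.map_cons, List.prod_cons, ih, rr, List.forall_mem_cons]
      have : compat x v ↔ compat v x := ⟨fun h => hsymm h, fun h => hsymm h⟩
      simp only [this]
      by_cases h1 : compat v x <;> simp [h1]
  rw [this]; simp only [hh, List.pairwise_cons]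
  by_cases h1 : ∀ y ∈ l, compat v y <;> by_cases h2 : l.Pairwise compat <;> simp [h1, h2]

/-- part of `u` incompatible with `v`, with a sign -/
def qq (v : ι) (l : List ι) : ℝ := (1 - (l.map (rr compat v)).prod) * uu compat l

theorem uu_rec2 (hsymm : Symmetric compat) (v x : ι) (l : List ι) :
    uu compat (v :: x :: l) = - sh l (D x (qq compat v)) (D v (uu compat)) := by
  have key : ∀ l, D x (D v (uu compat)) l
      = (fun l => (-1) * sh l (D x (qq compat v)) (D v (uu compat))) l := by
    apply sh_cancel _ _ (hh compat) (hh_nil compat)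
    intro l
    have e1 := uu_rec compat v (x :: l)
    rw [sh, hh_cons compat hsymm] at e1
    simp only [List.map_cons, List.prod_cons] at e1
    rw [← uu_rec compat x l, mul_assoc, ← sh_mult] at e1
    have e2 : (fun m => (List.map (rr compat v) m).prod * hh compat m)
        = fun m => sh m (D v (uu compat)) (hh compat) := by
      funext m; rw [uu_rec, hh_cons compat hsymm]
    rw [e2] at e1
    have e3 : D x (hh compat) = fun m => sh m (D x (uu compat)) (hh compat) := by
      funext m; rw [uu_rec]; rfl
    rw [e3, ← sh_assoc, ← sh_assoc, ← sh_smul_left] at e1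
    rw [eq_sub_of_add_eq e1, ← sh_sub_left]
    apply sh_congr
    · intro m _
      have : D x (qq compat v) = fun m => D x (uu compat) m -
          rr compat v x * ((m.map (rr compat v)).prod * D x (uu compat) m) := by
        funext m; simp [D, qq]; ring
      rw [this, sh_sub_left, sh_smul_left, sh_comm m (D v (uu compat)) (D x (uu compat))]
      ring
    · intros; rfl
  have := key l
  simp only [D] at this ⊢
  rw [this]; ring

end defu

section graph
variable {V : Type*} [DecidableEq V] (E0 : Finset (Sym2 V))

/-- edges inside `S` -/
def ES (E : Finset (Sym2 V)) (S : Finset V) : Finset (Sym2 V) := E.filter (fun e => ∀ x ∈ e, x ∈ S)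

/-- `E` connects `S` -/
def conn (S : Finset V) (E : Finset (Sym2 V)) : Prop :=
  ∀ x ∈ S, ∀ y ∈ S, (SimpleGraph.fromEdgeSet (↑E : Set (Sym2 V))).Reachable x y

/-- connected sum -/
def US (S : Finset V) : ℝ := ∑ E ∈ (ES E0 S).powerset.filter (conn S), (-1 : ℝ) ^ E.card

/-- full sum -/
def ZS (S : Finset V) : ℝ := ∑ E ∈ (ES E0 S).powerset, (-1 : ℝ) ^ E.card

theorem ZS_eq (S : Finset V) : ZS E0 S = if ES E0 S = ∅ then 1 else 0 := by
  have := Finset.sum_powerset_neg_one_pow_card (x := ES E0 S)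
  rw [ZS]
  have h2 := congrArg (fun z : ℤ => (z : ℝ)) this
  push_cast at h2
  rw [h2]

theorem mem_ES {E : Finset (Sym2 V)} {S : Finset V} {e : Sym2 V} :
    e ∈ ES E S ↔ e ∈ E ∧ ∀ x ∈ e, x ∈ S := by simp [ES]

/-- reachability stays in a block -/
theorem reach_block (E : Finset (Sym2 V)) (A B : Finset V) (hAB : Disjoint A B)
    (hE : ∀ e ∈ E, (∀ x ∈ e, x ∈ A) ∨ (∀ x ∈ e, x ∈ B)) (x y : V) (hx : x ∈ A)
    (h : (SimpleGraph.fromEdgeSet (↑E : Set (Sym2 V))).Reachable x y) :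
    y ∈ A ∧ (SimpleGraph.fromEdgeSet (↑(ES E A) : Set (Sym2 V))).Reachable x y := by
  rw [SimpleGraph.reachable_iff_reflTransGen] at h
  induction h with
  | refl => exact ⟨hx, SimpleGraph.Reachable.refl _⟩
  | tail _ hbc ih =>
    rename_i b c _
    obtain ⟨hb, hr⟩ := ih
    rw [SimpleGraph.fromEdgeSet_adj] at hbc
    have hmem : s(b, c) ∈ E := by simpa using hbc.1
    have hA : ∀ x ∈ s(b, c), x ∈ A := by
      rcases hE _ hmem with h1 | h1
      · exact h1
      · exact absurd (h1 b (by simp)) (Finset.disjoint_left.mp hAB hb)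
    refine ⟨hA c (by simp), hr.trans (SimpleGraph.Adj.reachable ?_)⟩
    rw [SimpleGraph.fromEdgeSet_adj]
    exact ⟨by simpa using mem_ES.2 ⟨hmem, hA⟩, hbc.2⟩

theorem block_split (E : Finset (Sym2 V)) (A B : Finset V)
    (hE : ∀ e ∈ E, (∀ x ∈ e, x ∈ A) ∨ (∀ x ∈ e, x ∈ B)) : ES E A ∪ ES E B = E := by
  ext e
  simp only [Finset.mem_union, mem_ES]
  have := hE e
  tauto

theorem ES_union (A B : Finset V) (hAB : Disjoint A B) (E1 E2 : Finset (Sym2 V))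
    (h1 : ∀ e ∈ E1, (∀ x ∈ e, x ∈ A)) (h2 : ∀ e ∈ E2, (∀ x ∈ e, x ∈ B)) :
    ES (E1 ∪ E2) A = E1 := by
  ext e
  simp only [Finset.mem_union, mem_ES]
  constructor
  · rintro ⟨h | h, h'⟩
    · exact h
    · exfalso
      induction e using Sym2.ind with
      | _ x y =>
        exact Finset.disjoint_left.mp hAB (h' x (by simp)) (h2 _ h x (by simp))
  · intro h; exact ⟨Or.inl h, h1 e h⟩

theorem ZS_rec (v : V) (S : Finset V) (hv : v ∉ S) :
    ZS E0 (insert v S) = ∑ T ∈ S.powerset, US E0 (insert v T) * ZS E0 (S \ T) := by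
  rw [ZS]
  rw [← Finset.sum_fiberwise_of_maps_to (s := (ES E0 (insert v S)).powerset) (t := S.powerset)
    (g := fun E => S.filter (fun x => (SimpleGraph.fromEdgeSet (↑E : Set (Sym2 V))).Reachable v x))
    (by intro E _; simp) (fun E => (-1 : ℝ) ^ E.card)]
  apply Finset.sum_congr rfl
  intro T hT
  rw [Finset.mem_powerset] at hT
  have hAB : Disjoint (insert v T) (S \ T) := by
    rw [Finset.disjoint_left]
    intro x hx
    simp only [Finset.mem_insert, Finset.mem_sdiff] at hx ⊢
    rintro ⟨h1, h2⟩
    rcases hx with rfl | hx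
    · exact hv h1
    · exact h2 hx
  rw [US, ZS, Finset.sum_mul_sum, ← Finset.sum_product']
  -- properties of E in the fiber
  have hfib : ∀ E ∈ (ES E0 (insert v S)).powerset.filter (fun E : Finset (Sym2 V) => S.filter (fun x =>
      (SimpleGraph.fromEdgeSet (↑E : Set (Sym2 V))).Reachable v x) = T),
      ∀ e ∈ E, (∀ x ∈ e, x ∈ insert v T) ∨ (∀ x ∈ e, x ∈ S \ T) := by
    intro E hE e he
    rw [Finset.mem_filter, Finset.mem_powerset] at hE
    obtain ⟨hE1, hE2⟩ := hE
    have hes := (mem_ES.1 (hE1 he)).2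
    induction e using Sym2.ind with
    | _ x y =>
      have hadj : (SimpleGraph.fromEdgeSet (↑E : Set (Sym2 V))).Reachable x y := by
        by_cases hxy : x = y
        · rw [hxy]
        · apply SimpleGraph.Adj.reachable
          rw [SimpleGraph.fromEdgeSet_adj]
          exact ⟨by simpa using he, hxy⟩
      have hA : ∀ z, z ∈ insert v S → (z ∈ insert v T ↔
          (SimpleGraph.fromEdgeSet (↑E : Set (Sym2 V))).Reachable v z) := by
        intro z hz
        rw [← hE2]
        simp only [Finset.mem_insert, Finset.mem_filter] at hz ⊢
        constructor
        · rintro (rfl | h)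
          · exact SimpleGraph.Reachable.refl _
          · exact h.2
        · intro h; rcases hz with rfl | hz
          · exact Or.inl rfl
          · exact Or.inr ⟨hz, h⟩
      have hB : ∀ z, z ∈ insert v S → z ∉ insert v T → z ∈ S \ T := by
        intro z hz hz'
        simp only [Finset.mem_insert, Finset.mem_sdiff] at hz hz' ⊢
        tauto
      have hx := hes x (by simp)
      have hy := hes y (by simp)
      have hiff : x ∈ insert v T ↔ y ∈ insert v T := by
        rw [hA x hx, hA y hy]
        exact ⟨fun h => h.trans hadj, fun h => h.trans hadj.symm⟩
      by_cases hxT : x ∈ insert v T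
      · left; intro z hz
        rw [Sym2.mem_iff] at hz
        rcases hz with rfl | rfl
        · exact hxT
        · exact hiff.1 hxT
      · right; intro z hz
        rw [Sym2.mem_iff] at hz
        rcases hz with rfl | rfl
        · exact hB _ hx hxT
        · exact hB _ hy (fun h => hxT (hiff.2 h))
  apply Finset.sum_nbij' (fun E => (ES E (insert v T), ES E (S \ T))) (fun p => p.1 ∪ p.2)
  · intro E hE
    have hf := hfib E hE
    rw [Finset.mem_filter, Finset.mem_powerset] at hE
    obtain ⟨hE1, hE2⟩ := hE
    simp only [Finset.mem_product, Finset.mem_filter, Finset.mem_powerset]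
    have hsub : ∀ A, ES E A ⊆ ES E0 A := by
      intro A e he
      rw [mem_ES] at he ⊢
      exact ⟨(mem_ES.1 (hE1 he.1)).1, he.2⟩
    refine ⟨⟨hsub _, ?_⟩, hsub _⟩
    have hr : ∀ z ∈ insert v T,
        (SimpleGraph.fromEdgeSet (↑(ES E (insert v T)) : Set (Sym2 V))).Reachable v z := by
      intro z hz
      have : (SimpleGraph.fromEdgeSet (↑E : Set (Sym2 V))).Reachable v z := by
        rw [Finset.mem_insert] at hz
        rcases hz with rfl | hz
        · exact SimpleGraph.Reachable.refl _
        · rw [← hE2, Finset.mem_filter] at hz; exact hz.2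
      exact (reach_block E _ _ hAB hf v z (by simp) this).2
    intro x hx y hy
    exact (hr x hx).symm.trans (hr y hy)
  · rintro ⟨E1, E2⟩ hE
    simp only [Finset.mem_product, Finset.mem_filter, Finset.mem_powerset] at hE ⊢
    obtain ⟨⟨h1, hc⟩, h2⟩ := hE
    have hs1 : ∀ e ∈ E1, ∀ x ∈ e, x ∈ insert v T := fun e he => (mem_ES.1 (h1 he)).2
    have hs2 : ∀ e ∈ E2, ∀ x ∈ e, x ∈ S \ T := fun e he => (mem_ES.1 (h2 he)).2
    constructor
    · intro e he
      rw [mem_ES]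
      rw [Finset.mem_union] at he
      rcases he with he | he
      · refine ⟨(mem_ES.1 (h1 he)).1, fun x hx => ?_⟩
        exact Finset.insert_subset_insert v hT (hs1 e he x hx)
      · refine ⟨(mem_ES.1 (h2 he)).1, fun x hx => ?_⟩
        exact Finset.mem_insert_of_mem (Finset.mem_sdiff.1 (hs2 e he x hx)).1
    · ext z
      rw [Finset.mem_filter]
      constructor
      · rintro ⟨hz, hr⟩
        have := (reach_block (E1 ∪ E2) _ _ hAB (by
          intro e he
          rw [Finset.mem_union] at he
          rcases he with he | he
          · exact Or.inl (hs1 e he)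
          · exact Or.inr (hs2 e he)) v z (by simp) hr).1
        rw [Finset.mem_insert] at this
        rcases this with rfl | h
        · exact absurd hz hv
        · exact h
      · intro hz
        refine ⟨hT hz, ?_⟩
        exact (hc v (by simp) z (by simp [hz])).mono
          (SimpleGraph.fromEdgeSet_mono (by simp))
  · intro E hE
    exact block_split E _ _ (hfib E hE)
  · rintro ⟨E1, E2⟩ hE
    simp only [Finset.mem_product, Finset.mem_filter, Finset.mem_powerset] at hE
    obtain ⟨⟨h1, hc⟩, h2⟩ := hE
    have hs1 : ∀ e ∈ E1, ∀ x ∈ e, x ∈ insert v T := fun e he => (mem_ES.1 (h1 he)).2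
    have hs2 : ∀ e ∈ E2, ∀ x ∈ e, x ∈ S \ T := fun e he => (mem_ES.1 (h2 he)).2
    simp only [Prod.mk.injEq]
    refine ⟨ES_union _ _ hAB _ _ hs1 hs2, ?_⟩
    rw [Finset.union_comm]
    exact ES_union _ _ hAB.symm _ _ hs2 hs1
  · intro E hE
    have hf := hfib E hE
    simp only
    rw [← pow_add, ← Finset.card_union_of_disjoint, block_split E _ _ hf]
    rw [Finset.disjoint_left]
    intro e h1 h2
    rw [mem_ES] at h1 h2
    induction e using Sym2.ind with
    | _ x y => exact Finset.disjoint_left.mp hAB (h1.2 x (by simp)) (h2.2 x (by simp))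

end graph

section ident
variable {ι : Type*} (compat : ι → ι → Prop)

theorem hh_ZS (hsymm : Symmetric compat) {n : ℕ} (Γ : Fin n → ι) (l : List (Fin n))
    (hl : l.Nodup) :
    hh compat (l.map Γ) = ZS (incompGraph compat Γ).edgeFinset l.toFinset := by
  rw [ZS_eq, hh]
  congr 1
  rw [List.pairwise_map, eq_iff_iff]
  have hsy : ∀ ⦃a b⦄, compat (Γ a) (Γ b) → compat (Γ b) (Γ a) := fun a b h => hsymm h
  have : List.Pairwise (fun a b => compat (Γ a) (Γ b)) l ↔
      ∀ a ∈ l, ∀ b ∈ l, a ≠ b → compat (Γ a) (Γ b) := by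
    constructor
    · intro h a ha b hb hab
      have : Std.Symm (fun a b => compat (Γ a) (Γ b)) := ⟨hsy⟩
      exact h.forall ha hb hab
    · intro h
      exact hl.imp_of_mem (fun ha hb hab => h _ ha _ hb hab)
  rw [this, Finset.eq_empty_iff_forall_notMem]
  constructor
  · intro h e he
    rw [mem_ES] at he
    induction e using Sym2.ind with
    | _ x y =>
      obtain ⟨h1, h2⟩ := he
      rw [SimpleGraph.mem_edgeFinset, SimpleGraph.mem_edgeSet, incompGraph,
        SimpleGraph.fromRel_adj] at h1
      have hx := h2 x (by simp)
      have hy := h2 y (by simp)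
      simp only [List.mem_toFinset] at hx hy
      rcases h1 with ⟨h3, h4 | h4⟩
      · exact h4 (h x hx y hy h3)
      · exact h4 (h y hy x hx h3.symm)
  · intro h a ha b hb hab
    by_contra hc
    apply h s(a, b)
    rw [mem_ES]
    constructor
    · rw [SimpleGraph.mem_edgeFinset, SimpleGraph.mem_edgeSet, incompGraph,
        SimpleGraph.fromRel_adj]
      exact ⟨hab, Or.inl hc⟩
    · intro x hx
      rw [Sym2.mem_iff] at hx
      rcases hx with rfl | rfl <;> simpa

theorem uu_US (hsymm : Symmetric compat) {n : ℕ} (Γ : Fin n → ι) : ∀ (k : ℕ) (l : List (Fin n)),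
    l.length = k → l.Nodup → l ≠ [] →
    uu compat (l.map Γ) = US (incompGraph compat Γ).edgeFinset l.toFinset := by
  intro k
  induction k using Nat.strong_induction_on with
  | _ k ih =>
    intro l hk hl hne
    cases l with
    | nil => exact absurd rfl hne
    | cons v l =>
      have hl' := List.nodup_cons.1 hl
      have hv : v ∉ l.toFinset := by simpa using hl'.1
      have e1 := uu_rec compat (Γ v) (l.map Γ)
      rw [← List.map_cons, hh_ZS compat hsymm Γ _ hl, List.toFinset_cons, ZS_rec _ _ _ hv,
        ← sh_finset l (fun T => US _ (insert v T)) (ZS _) hl'.2, sh_map] at e1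
      rw [sh_congr l (fun m => D (Γ v) (uu compat) (m.map Γ)) _ _
        (fun m => ZS (incompGraph compat Γ).edgeFinset m.toFinset) (fun _ _ => rfl)
        (fun m hm => hh_ZS compat hsymm Γ m (hl'.2.sublist hm))] at e1
      have e2 := sh_top_sub l (fun m => D (Γ v) (uu compat) (m.map Γ))
        (fun m => US (incompGraph compat Γ).edgeFinset (insert v m.toFinset))
        (fun m => ZS (incompGraph compat Γ).edgeFinset m.toFinset)
        (by rw [← hh_ZS compat hsymm Γ [] List.nodup_nil]; exact hh_nil compat)
        (by
          intro m hm hlen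
          have := ih (v :: m).length (by rw [← hk]; simpa using hlen) (v :: m) rfl
            (List.nodup_cons.2 ⟨fun h => hl'.1 (hm.subset h), hl'.2.sublist hm⟩) (by simp)
          rw [List.toFinset_cons] at this
          exact this)
      rw [e1] at e2
      rw [List.toFinset_cons]
      simp only [D] at e2
      simp only [List.map_cons]
      linarith

theorem ursell_uu (hsymm : Symmetric compat) {n : ℕ} (hn : 0 < n) (Γ : Fin n → ι) :
    ursell n (incompGraph compat Γ) = 1 / (n.factorial : ℝ) * uu compat (List.ofFn Γ) := by
  have h1 : List.ofFn Γ = (List.finRange n).map Γ := by simp [List.ofFn_eq_map]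
  have hne : List.finRange n ≠ [] := by
    intro h; have := congrArg List.length h; simp at this; omega
  rw [h1, uu_US compat hsymm Γ _ _ rfl (List.nodup_finRange n) hne, ursell, US]
  congr 1
  have : (List.finRange n).toFinset = Finset.univ := by ext; simp
  rw [this]
  apply Finset.sum_congr
  · have hE : ES (incompGraph compat Γ).edgeFinset Finset.univ = (incompGraph compat Γ).edgeFinset := by
      simp [ES]
    rw [hE]
    apply Finset.filter_congr
    intro s _
    have : Nonempty (Fin n) := ⟨⟨0, hn⟩⟩
    simp [conn, SimpleGraph.connected_iff, SimpleGraph.Preconnected, this]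
  · intros; rfl

theorem uu_perm (hsymm : Symmetric compat) {n : ℕ} (hn : 0 < n) (Γ : Fin n → ι)
    (σ : Equiv.Perm (Fin n)) : uu compat (List.ofFn (Γ ∘ σ)) = uu compat (List.ofFn Γ) := by
  have h1 : List.ofFn Γ = (List.finRange n).map Γ := by simp [List.ofFn_eq_map]
  have h2 : List.ofFn (Γ ∘ σ) = (List.ofFn σ).map Γ := by rw [List.map_ofFn]
  have hne : List.finRange n ≠ [] := by
    intro h; have := congrArg List.length h; simp at this; omega
  have hne2 : List.ofFn σ ≠ [] := by
    intro h; have := congrArg List.length h; simp at this; omega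
  rw [h1, h2, uu_US compat hsymm Γ _ _ rfl (List.nodup_finRange n) hne,
    uu_US compat hsymm Γ _ _ rfl (List.nodup_ofFn.2 σ.injective) hne2]
  congr 1
  ext x
  simpa using σ.surjective x

theorem uu_disconn (hsymm : Symmetric compat) {n : ℕ} (Γ : Fin n → ι)
    (h : ¬ (0 < n ∧ (incompGraph compat Γ).Connected)) : uu compat (List.ofFn Γ) = 0 := by
  rcases Nat.eq_zero_or_pos n with hn | hn
  · subst hn; simp [uu_nil]
  · have hc : ¬ (incompGraph compat Γ).Connected := fun hc => h ⟨hn, hc⟩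
    have h1 := ursell_uu compat hsymm hn Γ
    have h2 : ursell n (incompGraph compat Γ) = 0 := by
      rw [ursell, Finset.filter_false_of_mem]
      · simp
      · intro s hs hs'
        apply hc
        apply hs'.mono
        rw [Finset.mem_powerset] at hs
        intro x y hxy
        rw [SimpleGraph.fromEdgeSet_adj] at hxy
        have := hs (by simpa using hxy.1)
        simpa using this
    rw [h2] at h1
    have : (1 / (n.factorial : ℝ)) ≠ 0 := by positivity
    exact (mul_eq_zero.1 h1.symm).resolve_left this

end ident

section totals
variable {ι : Type*} [Fintype ι] (w : ι → ℝ)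

/-- total weight at order `n` -/
def tot : ℕ → (List ι → ℝ) → ℝ
  | 0, a => a []
  | n + 1, a => ∑ x, w x * tot n (D x a)

/-- coefficient at order `n` -/
def cf (a : List ι → ℝ) (n : ℕ) : ℝ := tot w n a / (n.factorial : ℝ)

theorem tot_eq (n : ℕ) : ∀ a : List ι → ℝ,
    tot w n a = ∑ Γ : Fin n → ι, a (List.ofFn Γ) * ∏ i, w (Γ i) := by
  induction n with
  | zero => intro a; simp [tot]
  | succ n ih =>
    intro a
    rw [tot, ← (Fin.consEquiv (fun _ : Fin (n+1) => ι)).sum_comp, Fintype.sum_prod_type]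
    apply Finset.sum_congr rfl
    intro x _
    rw [ih, Finset.mul_sum]
    apply Finset.sum_congr rfl
    intro Γ _
    simp [Fin.consEquiv, Fin.prod_univ_succ, D]
    ring

theorem tot_mono (hw : ∀ x, 0 ≤ w x) (n : ℕ) : ∀ a b : List ι → ℝ, (∀ l, a l ≤ b l) →
    tot w n a ≤ tot w n b := by
  induction n with
  | zero => intro a b h; exact h []
  | succ n ih =>
    intro a b h
    exact Finset.sum_le_sum fun x _ =>
      mul_le_mul_of_nonneg_left (ih _ _ fun l => h (x :: l)) (hw x)

theorem tot_smul (n : ℕ) (c : ℝ) : ∀ a : List ι → ℝ, tot w n (fun l => c * a l) = c * tot w n a := by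
  induction n with
  | zero => intro a; rfl
  | succ n ih =>
    intro a
    have h : ∀ x, D x (fun l => c * a l) = fun l => c * D x a l := fun x => rfl
    simp only [tot, h, ih, Finset.mul_sum]
    apply Finset.sum_congr rfl; intros; ring

theorem tot_add (n : ℕ) : ∀ a b : List ι → ℝ,
    tot w n (fun l => a l + b l) = tot w n a + tot w n b := by
  induction n with
  | zero => intro a b; rfl
  | succ n ih =>
    intro a b
    have h : ∀ x, D x (fun l => a l + b l) = fun l => D x a l + D x b l := fun x => rfl
    simp only [tot, h, ih, mul_add, Finset.sum_add_distrib]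

theorem cf_nonneg (hw : ∀ x, 0 ≤ w x) (a : List ι → ℝ) (ha : ∀ l, 0 ≤ a l) (n : ℕ) :
    0 ≤ cf w a n := by
  rw [cf, tot_eq]
  apply div_nonneg _ (by positivity)
  exact Finset.sum_nonneg fun Γ _ => mul_nonneg (ha _) (Finset.prod_nonneg fun i _ => hw _)

theorem cf_succ (a : List ι → ℝ) (n : ℕ) :
    (n + 1 : ℝ) * cf w a (n + 1) = ∑ x, w x * cf w (D x a) n := by
  simp only [cf, tot, Nat.factorial_succ]
  push_cast
  have h1 : (n + 1 : ℝ) ≠ 0 := by positivity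
  have h2 : (n.factorial : ℝ) ≠ 0 := by positivity
  rw [Finset.sum_div, Finset.mul_sum]
  apply Finset.sum_congr rfl
  intro x _
  field_simp

/-- generating series -/
def TT (a : List ι → ℝ) : PowerSeries ℝ := PowerSeries.mk (cf w a)

theorem dTT (a : List ι → ℝ) : PowerSeries.derivative ℝ (TT w a)
    = ∑ x, PowerSeries.C (w x) * TT w (D x a) := by
  ext n
  rw [PowerSeries.coeff_derivative, map_sum]
  simp only [TT, PowerSeries.coeff_mk, PowerSeries.coeff_C_mul]
  rw [← cf_succ]; ring

theorem TT_mul (n : ℕ) : ∀ a b : List ι → ℝ,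
    PowerSeries.coeff n (TT w (fun l => sh l a b)) = PowerSeries.coeff n (TT w a * TT w b) := by
  induction n with
  | zero =>
    intro a b
    simp [TT, cf, tot, sh, PowerSeries.coeff_mul]
  | succ n ih =>
    intro a b
    have h1 : (n + 1 : ℝ) ≠ 0 := by positivity
    apply mul_right_cancel₀ h1
    rw [← PowerSeries.coeff_derivative, ← PowerSeries.coeff_derivative, dTT, Derivation.leibniz,
      dTT, dTT]
    simp only [smul_eq_mul, Finset.mul_sum, map_add, map_sum]
    rw [← Finset.sum_add_distrib]
    apply Finset.sum_congr rfl
    intro x _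
    have h : TT w (D x (fun l => sh l a b)) = TT w (fun l => sh l (D x a) b) +
        TT w (fun l => sh l a (D x b)) := by
      ext k
      simp only [TT, PowerSeries.coeff_mk, map_add, cf]
      rw [← add_div, ← tot_add]; rfl
    rw [h, mul_add, map_add, PowerSeries.coeff_C_mul, PowerSeries.coeff_C_mul, ih, ih,
      ← PowerSeries.coeff_C_mul, ← PowerSeries.coeff_C_mul]
    rw [add_comm]
    congr 2 <;> ring

theorem cf_sh (a b : List ι → ℝ) (n : ℕ) :
    ∑ x, w x * cf w (fun l => sh l (D x a) b) n
      = ∑ p ∈ Finset.HasAntidiagonal.antidiagonal n, ((p.1 + 1 : ℝ) * cf w a (p.1 + 1)) * cf w b p.2 := by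
  have h1 : ∀ x, cf w (fun l => sh l (D x a) b) n
      = ∑ p ∈ Finset.HasAntidiagonal.antidiagonal n, cf w (D x a) p.1 * cf w b p.2 := by
    intro x
    have := TT_mul w n (D x a) b
    simpa [TT, PowerSeries.coeff_mul] using this
  simp only [h1, Finset.mul_sum, cf_succ, Finset.sum_mul]
  rw [Finset.sum_comm]
  apply Finset.sum_congr rfl; intros; apply Finset.sum_congr rfl; intros; ring

end totals

section analysis

theorem grow (p q : ℕ → ℝ) (hp : ∀ n, 0 ≤ p n) (hq : ∀ n, 0 ≤ q n) (hp0 : p 0 = 1) (hq0 : q 0 = 0)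
    (hr : ∀ n : ℕ, (n + 1 : ℝ) * p (n + 1)
      ≤ ∑ x ∈ Finset.HasAntidiagonal.antidiagonal n, ((x.1 + 1 : ℝ) * q (x.1 + 1)) * p x.2) (N : ℕ) :
    ∑ n ∈ Finset.range (N + 1), p n ≤ Real.exp (∑ n ∈ Finset.range (N + 1), q n) := by
  have hder : ∀ (c : ℕ → ℝ) (t : ℝ), HasDerivAt (fun t => ∑ n ∈ Finset.range (N + 1), c n * t ^ n)
      (∑ n ∈ Finset.range N, (n + 1 : ℝ) * c (n + 1) * t ^ n) t := by
    intro c t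
    have h := HasDerivAt.fun_sum (u := Finset.range (N + 1)) (A := fun n t => c n * t ^ n)
      (A' := fun n => c n * (n * t ^ (n - 1))) (x := t)
      (fun n _ => (hasDerivAt_pow n t).const_mul (c n))
    refine h.congr_deriv (Eq.symm ?_)
    rw [Finset.sum_range_succ']
    simp only [Nat.cast_zero, zero_mul, mul_zero, add_zero]
    apply Finset.sum_congr rfl
    intro n _
    push_cast
    ring_nf
  set P : ℝ → ℝ := fun t => ∑ n ∈ Finset.range (N + 1), p n * t ^ n with hP
  set Q : ℝ → ℝ := fun t => ∑ n ∈ Finset.range (N + 1), q n * t ^ n with hQ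
  have hF : ∀ t, HasDerivAt (fun t => P t * Real.exp (- Q t))
      ((∑ n ∈ Finset.range N, (n + 1 : ℝ) * p (n + 1) * t ^ n) * Real.exp (- Q t)
        + P t * (Real.exp (- Q t) * -(∑ n ∈ Finset.range N, (n + 1 : ℝ) * q (n + 1) * t ^ n))) t :=
    fun t => (hder p t).mul ((hder q t).neg.exp)
  have hle : ∀ t, 0 ≤ t → (∑ n ∈ Finset.range N, (n + 1 : ℝ) * p (n + 1) * t ^ n)
      ≤ (∑ n ∈ Finset.range N, (n + 1 : ℝ) * q (n + 1) * t ^ n) * P t := by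
    intro t ht
    have h1 : (∑ n ∈ Finset.range N, (n + 1 : ℝ) * p (n + 1) * t ^ n)
        ≤ ∑ n ∈ Finset.range N, ∑ x ∈ Finset.HasAntidiagonal.antidiagonal n,
          ((x.1 + 1 : ℝ) * q (x.1 + 1) * t ^ x.1) * (p x.2 * t ^ x.2) := by
      apply Finset.sum_le_sum
      intro n _
      refine (mul_le_mul_of_nonneg_right (hr n) (pow_nonneg ht n)).trans (le_of_eq ?_)
      rw [Finset.sum_mul]
      apply Finset.sum_congr rfl
      intro x hx
      rw [Finset.HasAntidiagonal.mem_antidiagonal] at hx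
      rw [← hx, pow_add]; ring
    refine h1.trans ?_
    rw [hP, Finset.sum_mul_sum, ← Finset.sum_product']
    have h2 := Finset.sum_fiberwise_of_maps_to
      (s := (Finset.range N ×ˢ Finset.range (N + 1)).filter (fun x : ℕ × ℕ => x.1 + x.2 < N))
      (t := Finset.range N) (g := fun x => x.1 + x.2) (by intro x hx; simp at hx ⊢; omega)
      (fun x => ((x.1 + 1 : ℝ) * q (x.1 + 1) * t ^ x.1) * (p x.2 * t ^ x.2))
    have h3 : ∀ n ∈ Finset.range N, Finset.HasAntidiagonal.antidiagonal n = ((Finset.range N ×ˢ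
        Finset.range (N + 1)).filter (fun x : ℕ × ℕ => x.1 + x.2 < N)).filter
          (fun x => x.1 + x.2 = n) := by
      intro n hn
      ext x
      simp at hn ⊢; omega
    rw [Finset.sum_congr rfl (fun n hn => by rw [h3 n hn]), h2]
    apply Finset.sum_le_sum_of_subset_of_nonneg (Finset.filter_subset _ _)
    intro x _ _
    have := hp x.2; have := hq (x.1 + 1)
    positivity
  have hanti : AntitoneOn (fun t => P t * Real.exp (- Q t)) (Set.Icc 0 1) := by
    apply antitoneOn_of_deriv_nonpos (convex_Icc 0 1)
    · exact fun t _ => (hF t).continuousAt.continuousWithinAt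
    · exact fun t _ => (hF t).differentiableAt.differentiableWithinAt
    · intro t ht
      rw [interior_Icc] at ht
      rw [(hF t).deriv]
      have := mul_le_mul_of_nonneg_right (hle t ht.1.le) (Real.exp_pos (- Q t)).le
      nlinarith
  have h01 := hanti (Set.left_mem_Icc.2 zero_le_one) (Set.right_mem_Icc.2 zero_le_one) zero_le_one
  have hP0 : P 0 = 1 := by simp [hP, Finset.sum_range_succ', hp0]
  have hQ0 : Q 0 = 0 := by simp [hQ, Finset.sum_range_succ', hq0]
  have hP1 : P 1 = ∑ n ∈ Finset.range (N + 1), p n := by simp [hP]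
  have hQ1 : Q 1 = ∑ n ∈ Finset.range (N + 1), q n := by simp [hQ]
  simp only [hP0, hQ0, hP1, hQ1, neg_zero, Real.exp_zero, mul_one, Real.exp_neg] at h01
  rwa [← div_eq_mul_inv, div_le_one (Real.exp_pos _)] at h01

theorem ser_cont (c : ℕ → ℝ) (hc : Summable fun n => |c n|) :
    ContinuousOn (fun t : ℝ => ∑' n, c n * t ^ n) (Set.Icc 0 1) := by
  apply continuousOn_tsum (u := fun n => |c n|) (fun n => by fun_prop) hc
  intro n t ht
  rw [Real.norm_eq_abs, abs_mul, abs_pow, abs_of_nonneg ht.1]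
  exact mul_le_of_le_one_right (abs_nonneg _) (pow_le_one₀ ht.1 ht.2)

theorem ser_deriv (c : ℕ → ℝ) (hc : Summable fun n : ℕ => |(n + 1 : ℝ) * c (n + 1)|) (t : ℝ)
    (ht : t ∈ Set.Ioo (-1 : ℝ) 1) :
    HasDerivAt (fun t : ℝ => ∑' n, c n * t ^ n) (∑' n : ℕ, ((n + 1 : ℝ) * c (n + 1)) * t ^ n) t := by
  have hs : Summable (fun n : ℕ => |(n : ℝ) * c n|) := by
    rw [← summable_nat_add_iff 1]; simpa using hc
  have hb : ∀ (n : ℕ) (y : ℝ), y ∈ Set.Ioo (-1 : ℝ) 1 → ‖c n * (n * y ^ (n - 1))‖ ≤ |(n : ℝ) * c n| := by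
    intro n y hy
    have hy' : |y| ≤ 1 := abs_le.2 ⟨hy.1.le, hy.2.le⟩
    rw [Real.norm_eq_abs, ← mul_assoc, abs_mul, abs_pow, mul_comm (c n)]
    exact mul_le_of_le_one_right (abs_nonneg _) (pow_le_one₀ (abs_nonneg _) hy')
  have h := hasDerivAt_tsum_of_isPreconnected (g := fun n t => c n * t ^ n)
    (g' := fun n t => c n * (n * t ^ (n - 1))) hs isOpen_Ioo isPreconnected_Ioo
    (fun n y _ => (hasDerivAt_pow n y).const_mul (c n)) hb
    (y₀ := 0) (by norm_num) (by
      apply summable_of_ne_finset_zero (s := {0})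
      intro n hn; simp at hn; simp [hn]) ht
  refine h.congr_deriv (Eq.symm ?_)
  rw [Summable.tsum_eq_zero_add (f := fun n : ℕ => c n * (n * t ^ (n - 1)))]
  · simp only [Nat.cast_zero, zero_mul, mul_zero, zero_add]
    apply tsum_congr
    intro n
    push_cast
    ring_nf
  · exact Summable.of_norm_bounded hs (fun n => hb n t ht)

theorem exp_ser (c h : ℕ → ℝ) (hc0 : c 0 = 0) (hh0 : h 0 = 1)
    (hc : Summable fun n : ℕ => |(n + 1 : ℝ) * c (n + 1)|)
    (hh : Summable fun n : ℕ => |(n + 1 : ℝ) * h (n + 1)|)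
    (hr : ∀ n : ℕ, (n + 1 : ℝ) * h (n + 1)
      = ∑ x ∈ Finset.HasAntidiagonal.antidiagonal n, ((x.1 + 1 : ℝ) * c (x.1 + 1)) * h x.2) :
    ∑' n, h n = Real.exp (∑' n, c n) := by
  have habs : ∀ c : ℕ → ℝ, (Summable fun n : ℕ => |(n + 1 : ℝ) * c (n + 1)|) →
      Summable fun n => |c n| := by
    intro c hc
    rw [← summable_nat_add_iff 1]
    refine Summable.of_nonneg_of_le (fun n => abs_nonneg _) (fun n => ?_) hc
    rw [abs_mul]
    apply le_mul_of_one_le_left (abs_nonneg _)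
    rw [abs_of_nonneg (by positivity)]
    linarith [(Nat.cast_nonneg n : (0:ℝ) ≤ n)]
  set L : ℝ → ℝ := fun t => ∑' n, c n * t ^ n with hL
  set H : ℝ → ℝ := fun t => ∑' n, h n * t ^ n with hH
  have hconst := constant_of_has_deriv_right_zero (f := fun t => H t * Real.exp (- L t))
    (a := 0) (b := 1)
    ((ser_cont h (habs h hh)).mul (Real.continuous_exp.comp_continuousOn (ser_cont c (habs c hc)).neg))
    (by
      intro t ht
      have ht' : t ∈ Set.Ioo (-1 : ℝ) 1 := ⟨by linarith [ht.1], ht.2⟩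
      have h1 := (ser_deriv h hh t ht').mul (ser_deriv c hc t ht').neg.exp
      have hpw : ∀ c : ℕ → ℝ, (Summable fun n => |c n|) → Summable fun n => ‖c n * t ^ n‖ := by
        intro c hc
        refine Summable.of_nonneg_of_le (fun n => norm_nonneg _) (fun n => ?_) hc
        rw [Real.norm_eq_abs, abs_mul, abs_pow, abs_of_nonneg ht.1]
        exact mul_le_of_le_one_right (abs_nonneg _) (pow_le_one₀ ht.1 ht.2.le)
      have h2 := tsum_mul_tsum_eq_tsum_sum_antidiagonal_of_summable_norm
        (hpw (fun n : ℕ => (n + 1 : ℝ) * c (n + 1)) hc) (hpw h (habs h hh))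
      have h3 : (∑' n : ℕ, ((n + 1 : ℝ) * h (n + 1)) * t ^ n)
          = (∑' n : ℕ, ((n + 1 : ℝ) * c (n + 1)) * t ^ n) * H t := by
        rw [h2]
        apply tsum_congr
        intro n
        rw [hr, Finset.sum_mul]
        apply Finset.sum_congr rfl
        intro x hx
        rw [Finset.HasAntidiagonal.mem_antidiagonal] at hx
        rw [← hx, pow_add]; ring
      refine HasDerivAt.hasDerivWithinAt ?_
      refine h1.congr_deriv ?_
      rw [h3]; ring)
    1 (by norm_num)
  have e1 : H 0 = 1 := by
    rw [hH]; simp only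
    rw [tsum_eq_single 0 (by intro n hn; simp [hn])]; simp [hh0]
  have e2 : L 0 = 0 := by
    rw [hL]; simp only
    rw [tsum_eq_single 0 (by intro n hn; simp [hn])]; simp [hc0]
  have e3 : H 1 = ∑' n, h n := by simp [hH]
  have e4 : L 1 = ∑' n, c n := by simp [hL]
  simp only [e1, e2, e3, e4, neg_zero, Real.exp_zero, mul_one, Real.exp_neg] at hconst
  rw [← div_eq_mul_inv, div_eq_one_iff_eq (Real.exp_pos _).ne'] at hconst
  exact hconst

end analysis

section main
variable {ι : Type*} [Fintype ι] (compat : ι → ι → Prop)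

/-- indicator of a set of polymers -/
def ind (Λ : Finset ι) (x : ι) : ℝ := if x ∈ Λ then 1 else 0

/-- pairwise compatible sets -/
def cc (Θ : Finset ι) : Prop := ∀ A ∈ Θ, ∀ B ∈ Θ, A ≠ B → compat A B

theorem tot_hh (hsymm : Symmetric compat) (hirr : ∀ A, ¬ compat A A) (w : ι → ℝ) (n : ℕ) :
    ∀ Λ : Finset ι, tot w n (fun l => (l.map (ind Λ)).prod * hh compat l)
      = (n.factorial : ℝ) * ∑ Θ ∈ (Λ.powersetCard n).filter (cc compat), ∏ A ∈ Θ, w A := by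
  induction n with
  | zero =>
    intro Λ
    have : ({∅} : Finset (Finset ι)).filter (cc compat) = {∅} := by
      ext T; simp only [Finset.mem_filter, Finset.mem_singleton]
      constructor
      · exact fun h => h.1
      · rintro rfl; exact ⟨rfl, by simp [cc]⟩
    simp [tot, hh_nil, this]
  | succ n ih =>
    intro Λ
    have h1 : ∀ x, D x (fun l => (l.map (ind Λ)).prod * hh compat l) = fun l => ind Λ x *
        ((l.map (ind (Λ.filter (fun y => compat y x)))).prod * hh compat l) := by
      intro x; funext l
      simp only [D, List.map_cons, List.prod_cons, hh_cons compat hsymm]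
      have : (l.map (ind (Λ.filter (fun y => compat y x)))).prod
          = (l.map (ind Λ)).prod * (l.map (rr compat x)).prod := by
        rw [← List.prod_map_mul]
        congr 2; funext y
        simp only [ind, rr, Finset.mem_filter]
        by_cases h1 : y ∈ Λ <;> by_cases h2 : compat y x <;> simp [h1, h2]
      rw [this]; ring
    simp only [tot, h1, tot_smul, ih]
    have h2 : ∀ Θ ∈ (Λ.powersetCard (n + 1)).filter (cc compat),
        ((n + 1 : ℕ) : ℝ) * ∏ A ∈ Θ, w A = ∑ x ∈ Θ, w x * ∏ A ∈ Θ.erase x, w A := by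
      intro Θ hΘ
      rw [Finset.sum_congr rfl (fun x hx => Finset.mul_prod_erase Θ w hx)]
      rw [Finset.mem_filter, Finset.mem_powersetCard] at hΘ
      rw [Finset.sum_const, hΘ.1.2, nsmul_eq_mul]
    rw [Nat.factorial_succ]
    push_cast
    rw [mul_comm ((n : ℝ) + 1), mul_assoc, Finset.mul_sum (a := (n : ℝ) + 1)]
    push_cast at h2
    rw [Finset.sum_congr rfl h2]
    have h3 : ∀ x, w x * (ind Λ x * ((n.factorial : ℝ) * ∑ Θ ∈ ((Λ.filter
        (fun y => compat y x)).powersetCard n).filter (cc compat), ∏ A ∈ Θ, w A))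
        = (n.factorial : ℝ) * (if x ∈ Λ then ∑ Θ ∈ ((Λ.filter
        (fun y => compat y x)).powersetCard n).filter (cc compat), w x * ∏ A ∈ Θ, w A else 0) := by
      intro x
      by_cases hx : x ∈ Λ
      · simp only [ind, hx, if_true, Finset.mul_sum]
        apply Finset.sum_congr rfl; intros; ring
      · simp [ind, hx]
    simp only [h3]
    rw [← Finset.mul_sum]
    congr 1
    rw [Finset.sum_ite_mem, Finset.univ_inter, Finset.sum_sigma', Finset.sum_sigma']
    apply Finset.sum_nbij' (fun p => ⟨insert p.1 p.2, p.1⟩) (fun p => ⟨p.2, p.1.erase p.2⟩)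
    · rintro ⟨x, Θ⟩ h
      simp only [Finset.mem_sigma, Finset.mem_filter, Finset.mem_powersetCard] at h ⊢
      obtain ⟨hx, ⟨hs, hcard⟩, hcc⟩ := h
      have hxΘ : x ∉ Θ := fun h => hirr x (Finset.mem_filter.1 (hs h)).2
      refine ⟨⟨⟨?_, ?_⟩, ?_⟩, by simp⟩
      · exact Finset.insert_subset hx (hs.trans (Finset.filter_subset _ _))
      · rw [Finset.card_insert_of_notMem hxΘ, hcard]
      · intro A hA B hB hAB
        rw [Finset.mem_insert] at hA hB
        rcases hA with rfl | hA <;> rcases hB with rfl | hB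
        · exact absurd rfl hAB
        · exact hsymm (Finset.mem_filter.1 (hs hB)).2
        · exact (Finset.mem_filter.1 (hs hA)).2
        · exact hcc A hA B hB hAB
    · rintro ⟨Θ, x⟩ h
      simp only [Finset.mem_sigma, Finset.mem_filter, Finset.mem_powersetCard] at h ⊢
      obtain ⟨⟨⟨hs, hcard⟩, hcc⟩, hx⟩ := h
      refine ⟨hs hx, ⟨?_, ?_⟩, ?_⟩
      · intro y hy
        rw [Finset.mem_erase] at hy
        exact Finset.mem_filter.2 ⟨hs hy.2, hcc y hy.2 x hx hy.1⟩
      · rw [Finset.card_erase_of_mem hx, hcard]; rfl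
      · intro A hA B hB hAB
        exact hcc A (Finset.mem_of_mem_erase hA) B (Finset.mem_of_mem_erase hB) hAB
    · rintro ⟨x, Θ⟩ h
      simp only [Finset.mem_sigma, Finset.mem_filter, Finset.mem_powersetCard] at h
      obtain ⟨hx, ⟨hs, hcard⟩, hcc⟩ := h
      have hxΘ : x ∉ Θ := fun h => hirr x (Finset.mem_filter.1 (hs h)).2
      simp [Finset.erase_insert hxΘ]
    · rintro ⟨Θ, x⟩ h
      simp only [Finset.mem_sigma] at h
      simp [Finset.insert_erase h.2]
    · rintro ⟨x, Θ⟩ h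
      simp only [Finset.mem_sigma, Finset.mem_filter, Finset.mem_powersetCard] at h
      obtain ⟨hx, ⟨hs, hcard⟩, hcc⟩ := h
      have hxΘ : x ∉ Θ := fun h => hirr x (Finset.mem_filter.1 (hs h)).2
      simp [Finset.erase_insert hxΘ]

theorem cf_hh (hsymm : Symmetric compat) (hirr : ∀ A, ¬ compat A A) (w : ι → ℝ) (n : ℕ) :
    cf w (hh compat) n
      = ∑ Θ ∈ ((Finset.univ : Finset ι).powersetCard n).filter (cc compat), ∏ A ∈ Θ, w A := by
  have h := tot_hh compat hsymm hirr w n Finset.univ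
  have h1 : (fun l => (l.map (ind (Finset.univ : Finset ι))).prod * hh compat l) = hh compat := by
    funext l
    have : ind (Finset.univ : Finset ι) = fun _ => 1 := by funext x; simp [ind]
    simp [this]
  rw [h1] at h
  rw [cf, h]
  have h2 : (n.factorial : ℝ) ≠ 0 := by positivity
  field_simp

theorem cf_hh_zero (hsymm : Symmetric compat) (hirr : ∀ A, ¬ compat A A) (w : ι → ℝ) (n : ℕ)
    (hn : Fintype.card ι < n) : cf w (hh compat) n = 0 := by
  rw [cf_hh compat hsymm hirr, Finset.powersetCard_eq_empty.2 (by simpa using hn)]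
  simp

theorem tsum_hh (hsymm : Symmetric compat) (hirr : ∀ A, ¬ compat A A) (w : ι → ℝ) :
    ∑' n, cf w (hh compat) n = polymerPartition compat w := by
  rw [tsum_eq_sum (s := Finset.range (Fintype.card ι + 1))
    (fun n hn => cf_hh_zero compat hsymm hirr w n (by simp at hn; omega))]
  simp only [cf_hh compat hsymm hirr]
  rw [polymerPartition, ← Finset.sum_fiberwise_of_maps_to
    (s := (Finset.univ : Finset (Finset ι)).filter
      (fun Θ => ∀ A ∈ Θ, ∀ B ∈ Θ, A ≠ B → compat A B))
    (t := Finset.range (Fintype.card ι + 1)) (g := Finset.card)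
    (by intro Θ _; have := Finset.card_le_univ Θ; simp; omega) (fun Θ => ∏ A ∈ Θ, w A)]
  apply Finset.sum_congr rfl
  intro n _
  apply Finset.sum_congr _ (fun _ _ => rfl)
  ext Θ
  simp only [Finset.mem_filter, Finset.mem_powersetCard, Finset.mem_univ, Finset.subset_univ,
    true_and, cc]
  tauto


theorem rr_cases (v x : ι) : rr compat v x = 0 ∨ rr compat v x = 1 := by
  rw [rr]; split_ifs <;> simp

theorem prod_rr (v : ι) (l : List ι) :
    0 ≤ (l.map (rr compat v)).prod ∧ (l.map (rr compat v)).prod ≤ 1 ∧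
    1 - (l.map (rr compat v)).prod ≤ (l.map (fun x => 1 - rr compat v x)).sum := by
  induction l with
  | nil => simp
  | cons x l ih =>
    obtain ⟨h1, h2, h3⟩ := ih
    simp only [List.map_cons, List.prod_cons, List.sum_cons]
    rcases rr_cases compat v x with h | h <;> rw [h]
    · refine ⟨by simp, by simp, ?_⟩
      linarith
    · refine ⟨by linarith, by linarith, by linarith⟩

theorem qq_abs (v : ι) (l : List ι) :
    |qq compat v l| = (1 - (l.map (rr compat v)).prod) * |uu compat l| := by
  rw [qq, abs_mul, abs_of_nonneg]
  linarith [(prod_rr compat v l).2.1]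

/-- symmetrization -/
theorem cf_qq (hsymm : Symmetric compat) (w : ι → ℝ) (hw : ∀ x, 0 ≤ w x) (v : ι) (n : ℕ) :
    cf w (fun l => |qq compat v l|) (n + 1)
      ≤ ∑ x, w x * ((1 - rr compat v x) * cf w (fun l => |uu compat (x :: l)|) n) := by
  have e0 : ∀ i : Fin (n + 1),
      ∑ Γ : Fin (n + 1) → ι, (1 - rr compat v (Γ i)) * |uu compat (List.ofFn Γ)| * ∏ j, w (Γ j)
      = ∑ Γ : Fin (n + 1) → ι, (1 - rr compat v (Γ 0)) * |uu compat (List.ofFn Γ)| * ∏ j, w (Γ j) := by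
    intro i
    rw [← (Equiv.arrowCongr (Equiv.swap 0 i) (Equiv.refl ι)).sum_comp]
    apply Finset.sum_congr rfl
    intro Γ _
    have h1 : (Equiv.arrowCongr (Equiv.swap 0 i) (Equiv.refl ι)) Γ = Γ ∘ (Equiv.swap 0 i) := by
      funext j; simp [Equiv.arrowCongr]
    rw [h1, uu_perm compat hsymm (Nat.succ_pos n)]
    have h2 : ∏ j, w ((Γ ∘ (Equiv.swap 0 i)) j) = ∏ j, w (Γ j) :=
      Equiv.prod_comp (Equiv.swap 0 i) (fun j => w (Γ j))
    rw [h2]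
    simp
  have e1 : tot w (n + 1) (fun l => |qq compat v l|) ≤ (n + 1 : ℝ) *
      ∑ Γ : Fin (n + 1) → ι, (1 - rr compat v (Γ 0)) * |uu compat (List.ofFn Γ)| * ∏ j, w (Γ j) := by
    calc tot w (n + 1) (fun l => |qq compat v l|)
        ≤ ∑ Γ : Fin (n + 1) → ι, ∑ i, (1 - rr compat v (Γ i)) * |uu compat (List.ofFn Γ)|
            * ∏ j, w (Γ j) := by
          rw [tot_eq]
          apply Finset.sum_le_sum
          intro Γ _
          rw [← Finset.sum_mul, ← Finset.sum_mul]
          apply mul_le_mul_of_nonneg_right _ (Finset.prod_nonneg fun i _ => hw _)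
          rw [qq_abs]
          apply mul_le_mul_of_nonneg_right _ (abs_nonneg _)
          have := (prod_rr compat v (List.ofFn Γ)).2.2
          rw [show (List.map (fun x => 1 - rr compat v x) (List.ofFn Γ)).sum
            = ∑ i, (1 - rr compat v (Γ i)) from by rw [List.map_ofFn, List.sum_ofFn]; rfl] at this
          exact this
      _ = _ := by
          rw [Finset.sum_comm, Finset.sum_congr rfl (fun i _ => e0 i)]
          simp
  have e2 : ∑ Γ : Fin (n + 1) → ι, (1 - rr compat v (Γ 0)) * |uu compat (List.ofFn Γ)|
      * ∏ j, w (Γ j) = ∑ x, w x * ((1 - rr compat v x) * tot w n (fun l => |uu compat (x :: l)|)) := by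
    have h1 := tot_eq w (n + 1) (fun l => (l.head?.elim 0 (fun x => 1 - rr compat v x))
      * |uu compat l|)
    have h2 : ∀ x, D x (fun l : List ι => (l.head?.elim 0 (fun x => 1 - rr compat v x))
      * |uu compat l|) = fun l => (1 - rr compat v x) * |uu compat (x :: l)| := fun x => rfl
    simp only [tot, h2, tot_smul] at h1
    rw [h1]
    apply Finset.sum_congr rfl
    intro Γ _
    simp [List.ofFn_succ]
  rw [e2] at e1
  simp only [cf, Nat.factorial_succ]
  push_cast
  have h1 : (0:ℝ) < n + 1 := by positivity
  have h2 : (0:ℝ) < n.factorial := by positivity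
  rw [div_le_iff₀ (by positivity)]
  refine e1.trans (le_of_eq ?_)
  rw [Finset.mul_sum, Finset.sum_mul]
  apply Finset.sum_congr rfl
  intro x _
  field_simp

theorem uu_single (v : ι) : uu compat [v] = 1 := by
  have := uu_rec compat v []
  simpa [sh, D, hh] using this

theorem exp_bound (hsymm : Symmetric compat) (w : ι → ℝ) (hw : ∀ x, 0 ≤ w x) (v : ι) (N : ℕ) :
    ∑ n ∈ Finset.range (N + 1), cf w (fun l => |uu compat (v :: l)|) n
      ≤ Real.exp (∑ n ∈ Finset.range (N + 1), cf w (fun l => |qq compat v l|) n) := by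
  apply grow
  · exact fun n => cf_nonneg w hw _ (fun l => abs_nonneg _) n
  · exact fun n => cf_nonneg w hw _ (fun l => abs_nonneg _) n
  · simp [cf, tot, uu_single]
  · simp [cf, tot, qq, uu_nil]
  · intro n
    rw [← cf_sh, cf_succ]
    apply Finset.sum_le_sum
    intro x _
    apply mul_le_mul_of_nonneg_left _ (hw x)
    rw [cf, cf]
    apply div_le_div_of_nonneg_right _ (by positivity)
    apply tot_mono w hw
    intro l
    simp only [D]
    rw [uu_rec2 compat hsymm, abs_neg]
    exact sh_abs l _ _

theorem bound (hsymm : Symmetric compat) (w : ι → ℝ) (hw : ∀ x, 0 ≤ w x) (f : ι → ℝ)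
    (hf : ∀ x, 0 ≤ f x)
    (hKP : ∀ A : ι, ∑ A' ∈ Finset.univ.filter (fun A' => ¬ compat A' A), w A' * Real.exp (f A')
      ≤ f A) (N : ℕ) :
    ∀ v, ∑ n ∈ Finset.range (N + 1), cf w (fun l => |qq compat v l|) n ≤ f v := by
  induction N with
  | zero => intro v; simpa [cf, tot, qq, uu_nil] using hf v
  | succ N ih =>
    intro v
    rw [Finset.sum_range_succ']
    have h0 : cf w (fun l => |qq compat v l|) 0 = 0 := by simp [cf, tot, qq, uu_nil]
    rw [h0, add_zero]
    refine (Finset.sum_le_sum fun n _ => cf_qq compat hsymm w hw v n).trans ?_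
    rw [Finset.sum_comm]
    refine le_trans ?_ (hKP v)
    rw [Finset.sum_filter]
    apply Finset.sum_le_sum
    intro x _
    rw [← Finset.mul_sum, ← Finset.mul_sum]
    have hb := (exp_bound compat hsymm w hw x N).trans (Real.exp_le_exp.2 (ih x))
    by_cases hx : compat x v
    · simp [rr, hx]
    · simp only [rr, hx, if_false, sub_zero, one_mul, not_false_eq_true, if_true]
      exact mul_le_mul_of_nonneg_left hb (hw x)

theorem fin_bound (w : ι → ℝ) (hw : ∀ x, 0 ≤ w x) (a : List ι → ℝ) (ha : ∀ l, 0 ≤ a l) (C : ℝ)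
    (hC : ∀ N, ∑ n ∈ Finset.range (N + 1), cf w a n ≤ C) (s : Finset (Σ n : ℕ, (Fin n → ι))) :
    ∑ p ∈ s, a (List.ofFn p.2) / (p.1.factorial : ℝ) * ∏ i, w (p.2 i) ≤ C := by
  refine le_trans ?_ (hC (s.sup Sigma.fst))
  have h1 : s ⊆ (Finset.range (s.sup Sigma.fst + 1)).sigma (fun n => (Finset.univ : Finset (Fin n → ι))) := by
    intro p hp
    have := Finset.le_sup (f := Sigma.fst) hp
    simp; omega
  refine (Finset.sum_le_sum_of_subset_of_nonneg h1 (fun p _ _ =>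
    mul_nonneg (div_nonneg (ha _) (by positivity)) (Finset.prod_nonneg fun i _ => hw _))).trans
    (le_of_eq ?_)
  rw [Finset.sum_sigma]
  apply Finset.sum_congr rfl
  intro n _
  rw [cf, tot_eq, Finset.sum_div]
  apply Finset.sum_congr rfl
  intro Γ _
  simp only
  ring

/-- forget connectedness -/
def toSig (Γ : Cluster ι compat) : Σ n : ℕ, (Fin n → ι) := ⟨Γ.n, Γ.Γ⟩

theorem toSig_inj : Function.Injective (toSig compat) := by
  rintro ⟨n, h1, Γ, h2⟩ ⟨m, h3, Δ, h4⟩ h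
  simp only [toSig, Sigma.mk.injEq] at h
  obtain ⟨rfl, h⟩ := h
  cases h
  rfl

theorem cw_eq (hsymm : Symmetric compat) (w : ι → ℝ) (Γ : Cluster ι compat) :
    clusterWeight compat w Γ
      = uu compat (List.ofFn Γ.Γ) / (Γ.n.factorial : ℝ) * ∏ i, w (Γ.Γ i) := by
  rw [clusterWeight, ursell_uu compat hsymm Γ.npos]; ring

theorem cw_abs (hsymm : Symmetric compat) (w : ι → ℝ) (hw : ∀ x, 0 ≤ w x) (Γ : Cluster ι compat) :
    |clusterWeight compat w Γ|
      = |uu compat (List.ofFn Γ.Γ)| / (Γ.n.factorial : ℝ) * ∏ i, w (Γ.Γ i) := by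
  rw [cw_eq compat hsymm, abs_mul, abs_div, Nat.abs_cast,
    abs_of_nonneg (Finset.prod_nonneg fun i _ => hw _)]

theorem qq_incomp (v : ι) {n : ℕ} (Γ : Fin n → ι) (h : ∃ i, ¬ compat (Γ i) v) :
    |qq compat v (List.ofFn Γ)| = |uu compat (List.ofFn Γ)| := by
  obtain ⟨i, hi⟩ := h
  rw [qq_abs]
  have : ((List.ofFn Γ).map (rr compat v)).prod = 0 := by
    rw [List.map_ofFn, List.prod_ofFn]
    exact Finset.prod_eq_zero (Finset.mem_univ i) (by simp [rr, hi])
  rw [this]; ring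

theorem abs_cf_le (w : ι → ℝ) (hw : ∀ x, 0 ≤ w x) (a : List ι → ℝ) (n : ℕ) :
    |cf w a n| ≤ cf w (fun l => |a l|) n := by
  rw [cf, cf, abs_div, Nat.abs_cast]
  apply div_le_div_of_nonneg_right _ (by positivity)
  rw [tot_eq, tot_eq]
  refine (Finset.abs_sum_le_sum_abs _ _).trans (le_of_eq ?_)
  apply Finset.sum_congr rfl
  intro Γ _
  rw [abs_mul, abs_of_nonneg (Finset.prod_nonneg fun i _ => hw _)]

theorem part3 (hsymm : Symmetric compat)
    (w : ι → ℝ) (hw : ∀ A, 0 ≤ w A)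
    (f g : ι → ℝ) (hf : ∀ A, 0 ≤ f A)
    (hKP : ∀ A : ι,
      ∑ A' ∈ Finset.univ.filter (fun A' => ¬ compat A' A),
        w A' * Real.exp (f A' + g A') ≤ f A) (A : ι) :
      Summable (fun Γ : {Γ : Cluster ι compat // ∃ i, ¬ compat (Γ.Γ i) A} =>
        |clusterWeight compat w Γ.1| * Real.exp (∑ i, g (Γ.1.Γ i))) ∧
      ∑' Γ : {Γ : Cluster ι compat // ∃ i, ¬ compat (Γ.Γ i) A},
        |clusterWeight compat w Γ.1| * Real.exp (∑ i, g (Γ.1.Γ i)) ≤ f A := by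
  set W : ι → ℝ := fun x => w x * Real.exp (g x) with hWdef
  have hW : ∀ x, 0 ≤ W x := fun x => mul_nonneg (hw x) (Real.exp_pos _).le
  have hb := fun N => bound compat hsymm W hW f hf (by
    intro A
    refine le_trans (le_of_eq ?_) (hKP A)
    apply Finset.sum_congr rfl
    intro x _
    rw [hWdef, Real.exp_add]; ring) N A
  have hfin := fin_bound W hW (fun l => |qq compat A l|) (fun l => abs_nonneg _) (f A) hb
  have heq : ∀ Γ : {Γ : Cluster ι compat // ∃ i, ¬ compat (Γ.Γ i) A},
      |clusterWeight compat w Γ.1| * Real.exp (∑ i, g (Γ.1.Γ i))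
      = (fun p : Σ n : ℕ, (Fin n → ι) => |qq compat A (List.ofFn p.2)| / (p.1.factorial : ℝ)
        * ∏ i, W (p.2 i)) (toSig compat Γ.1) := by
    intro Γ
    simp only [toSig]
    rw [qq_incomp compat A Γ.1.Γ Γ.2, cw_abs compat hsymm w hw, hWdef, Real.exp_sum,
      Finset.prod_mul_distrib, mul_assoc]
    rfl
  have hfin2 : ∀ s : Finset {Γ : Cluster ι compat // ∃ i, ¬ compat (Γ.Γ i) A},
      ∑ Γ ∈ s, |clusterWeight compat w Γ.1| * Real.exp (∑ i, g (Γ.1.Γ i)) ≤ f A := by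
    intro s
    have h := hfin (s.map ⟨fun Γ => toSig compat Γ.1,
      fun _ _ h => Subtype.ext (toSig_inj compat h)⟩)
    rw [Finset.sum_map] at h
    rw [Finset.sum_congr rfl (fun Γ _ => heq Γ)]
    exact h
  have hs := summable_of_sum_le (fun Γ : {Γ : Cluster ι compat // ∃ i, ¬ compat (Γ.Γ i) A} =>
    mul_nonneg (abs_nonneg (clusterWeight compat w Γ.1)) (Real.exp_pos (∑ i, g (Γ.1.Γ i))).le) hfin2
  exact ⟨hs, hs.tsum_le_of_sum_le hfin2⟩

theorem partition_pos (w : ι → ℝ) (hw : ∀ A, 0 ≤ w A) : 0 < polymerPartition compat w := by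
  rw [polymerPartition]
  refine lt_of_lt_of_le zero_lt_one ?_
  have := Finset.single_le_sum (f := fun Θ : Finset ι => ∏ A ∈ Θ, w A)
    (s := (Finset.univ : Finset (Finset ι)).filter
      (fun Θ => ∀ A ∈ Θ, ∀ B ∈ Θ, A ≠ B → compat A B))
    (fun Θ _ => Finset.prod_nonneg fun A _ => hw A) (a := ∅) (by simp)
  simpa using this

theorem part12 (hsymm : Symmetric compat) (hirr : ∀ A, ¬ compat A A)
    (w : ι → ℝ) (hw : ∀ A, 0 ≤ w A) (f : ι → ℝ) (hf : ∀ A, 0 ≤ f A)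
    (hKP : ∀ A : ι, ∑ A' ∈ Finset.univ.filter (fun A' => ¬ compat A' A), w A' * Real.exp (f A')
      ≤ f A) :
    Summable (fun Γ : Cluster ι compat => |clusterWeight compat w Γ|) ∧
    (∑' Γ : Cluster ι compat, clusterWeight compat w Γ =
      Real.log (polymerPartition compat w)) := by
  have hb := bound compat hsymm w hw f hf hKP
  have hsq : ∀ A, Summable (fun p : Σ n : ℕ, (Fin n → ι) =>
      |qq compat A (List.ofFn p.2)| / (p.1.factorial : ℝ) * ∏ i, w (p.2 i)) := fun A =>
    summable_of_sum_le (fun p => mul_nonneg (div_nonneg (abs_nonneg _) (by positivity))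
      (Finset.prod_nonneg fun i _ => hw _))
      (fin_bound w hw (fun l => |qq compat A l|) (fun l => abs_nonneg _) (f A) (fun N => hb N A))
  have hsu : Summable (fun p : Σ n : ℕ, (Fin n → ι) =>
      |uu compat (List.ofFn p.2)| / (p.1.factorial : ℝ) * ∏ i, w (p.2 i)) := by
    refine Summable.of_nonneg_of_le (fun p => mul_nonneg (div_nonneg (abs_nonneg _) (by positivity))
      (Finset.prod_nonneg fun i _ => hw _)) ?_ (summable_sum (s := Finset.univ) (fun A _ => hsq A))
    rintro ⟨n, Γ⟩
    have hnn : ∀ A ∈ (Finset.univ : Finset ι), 0 ≤ |qq compat A (List.ofFn Γ)| / (n.factorial : ℝ)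
        * ∏ i, w (Γ i) := fun A _ => mul_nonneg (div_nonneg (abs_nonneg _) (by positivity))
      (Finset.prod_nonneg fun i _ => hw _)
    rcases Nat.eq_zero_or_pos n with hn | hn
    · subst hn
      simpa [uu_nil] using Finset.sum_nonneg hnn
    · have := Finset.single_le_sum hnn (Finset.mem_univ (Γ ⟨0, hn⟩))
      rw [qq_incomp compat _ Γ ⟨⟨0, hn⟩, hirr _⟩] at this
      exact this
  have hs1 : Summable (fun Γ : Cluster ι compat => |clusterWeight compat w Γ|) := by
    have := hsu.comp_injective (toSig_inj compat)
    refine this.congr (fun Γ => ?_)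
    rw [cw_abs compat hsymm w hw]; rfl
  refine ⟨hs1, ?_⟩
  set F : (Σ n : ℕ, (Fin n → ι)) → ℝ := fun p =>
      uu compat (List.ofFn p.2) / (p.1.factorial : ℝ) * ∏ i, w (p.2 i) with hF
  have hsF : Summable F := by
    apply Summable.of_abs
    refine hsu.congr (fun p => ?_)
    rw [hF]
    simp only
    rw [abs_mul, abs_div, Nat.abs_cast, abs_of_nonneg (Finset.prod_nonneg fun i _ => hw _)]
  have e1 : ∑' Γ : Cluster ι compat, clusterWeight compat w Γ = ∑' p, F p := by
    rw [← (toSig_inj compat).tsum_eq (f := F)]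
    · apply tsum_congr
      intro Γ
      rw [cw_eq compat hsymm]; rfl
    · rintro ⟨n, Γ⟩ hp
      by_contra hc
      apply hp
      have : uu compat (List.ofFn Γ) = 0 := by
        apply uu_disconn compat hsymm
        rintro ⟨h1, h2⟩
        exact hc ⟨⟨n, h1, Γ, h2⟩, rfl⟩
      simp [hF, this]
  have e2 : ∑' p, F p = ∑' n, cf w (uu compat) n := by
    rw [hsF.tsum_sigma]
    apply tsum_congr
    intro n
    rw [tsum_fintype, cf, tot_eq, Finset.sum_div]
    apply Finset.sum_congr rfl
    intro Γ _
    simp only [hF]; ring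
  have e3 : ∑' n, cf w (hh compat) n = Real.exp (∑' n, cf w (uu compat) n) := by
    apply exp_ser
    · simp [cf, tot, uu_nil]
    · simp [cf, tot, hh_nil]
    · have hsx : ∀ x, Summable (fun n => cf w (fun l => |uu compat (x :: l)|) n) := by
        intro x
        apply summable_of_sum_range_le (c := Real.exp (f x))
          (fun n => cf_nonneg w hw _ (fun l => abs_nonneg _) n)
        intro n
        refine le_trans ?_ ((exp_bound compat hsymm w hw x n).trans (Real.exp_le_exp.2 (hb n x)))
        rw [Finset.sum_range_succ]
        linarith [cf_nonneg w hw (fun l => |uu compat (x :: l)|) (fun l => abs_nonneg _) n]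
      refine Summable.of_nonneg_of_le (fun n => abs_nonneg _) (fun n => ?_)
        (summable_sum (s := Finset.univ) (fun x _ => (hsx x).mul_left (w x)))
      rw [cf_succ]
      refine (Finset.abs_sum_le_sum_abs _ _).trans (Finset.sum_le_sum fun x _ => ?_)
      rw [abs_mul, abs_of_nonneg (hw x)]
      exact mul_le_mul_of_nonneg_left (abs_cf_le w hw _ n) (hw x)
    · apply summable_of_ne_finset_zero (s := Finset.range (Fintype.card ι))
      intro n hn
      rw [cf_hh_zero compat hsymm hirr w (n + 1) (by simp at hn; omega)]
      simp
    · intro n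
      rw [← cf_sh, cf_succ]
      apply Finset.sum_congr rfl
      intro x _
      congr 2
      funext l
      exact (uu_rec compat x l).symm
  rw [e1, e2, ← tsum_hh compat hsymm hirr, e3, Real.log_exp]

end main

end KP

theorem kotecky_preiss {ι : Type*} [Fintype ι]
    (compat : ι → ι → Prop) (hsymm : Symmetric compat) (hirr : ∀ A, ¬ compat A A)
    (w : ι → ℝ) (hw : ∀ A, 0 ≤ w A)
    (f g : ι → ℝ) (hf : ∀ A, 0 ≤ f A) (hg : ∀ A, 0 ≤ g A)
    (hKP : ∀ A : ι,
      ∑ A' ∈ Finset.univ.filter (fun A' => ¬ compat A' A),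
        w A' * Real.exp (f A' + g A') ≤ f A) :
    Summable (fun Γ : Cluster ι compat => |clusterWeight compat w Γ|) ∧
    (∑' Γ : Cluster ι compat, clusterWeight compat w Γ =
      Real.log (polymerPartition compat w)) ∧
    (∀ A : ι,
      Summable (fun Γ : {Γ : Cluster ι compat // ∃ i, ¬ compat (Γ.Γ i) A} =>
        |clusterWeight compat w Γ.1| * Real.exp (∑ i, g (Γ.1.Γ i))) ∧
      ∑' Γ : {Γ : Cluster ι compat // ∃ i, ¬ compat (Γ.Γ i) A},
        |clusterWeight compat w Γ.1| * Real.exp (∑ i, g (Γ.1.Γ i)) ≤ f A) := by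
  have h12 := KP.part12 compat hsymm hirr w hw f hf (by
    intro A
    refine le_trans (Finset.sum_le_sum fun x _ => ?_) (hKP A)
    apply mul_le_mul_of_nonneg_left _ (hw x)
    exact Real.exp_le_exp.2 (by linarith [hg x]))
  exact ⟨h12.1, h12.2, fun A => KP.part3 compat hsymm w hw f g hf hKP A⟩
end
end
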